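/- Let G be a finite simple connected graph with edge set E and let e ∈ E. If e is contained in some non-interleaved cycle of G, then the inequality x_e ≤ 1 is not facet-defining for BOND(G). -/

import Mathlib

open Finset

namespace BondPolytope

variable {V : Type*}

/-- The cut `δ(S)`: edges of `G` with exactly one endpoint in `S`. -/
def cut (G : SimpleGraph V) (S : Set V) : Set (Sym2 V) :=
  {e | e ∈ G.edgeSet ∧ ∃ u w, e = s(u, w) ∧ u ∈ S ∧ w ∉ S}

/-- A set of edges is a cut of `G`. -/
def IsCut (G : SimpleGraph V) (D : Set (Sym2 V)) : Prop :=
  ∃ S : Set V, D = cut G S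

/-- A set of edges is a bond of `G`: it is a cut `δ(S)` such that both sides induce
connected (possibly empty) subgraphs. -/
def IsBond (G : SimpleGraph V) (D : Set (Sym2 V)) : Prop :=
  ∃ S : Set V, D = cut G S ∧ (G.induce S).Preconnected ∧ (G.induce Sᶜ).Preconnected

open Classical in
/-- The indicator vector `x^δ ∈ ℝ^E` of a set `δ` of edges. -/
noncomputable def indVec (G : SimpleGraph V) (D : Set (Sym2 V)) : ↥G.edgeSet → ℝ :=
  fun e => if (e : Sym2 V) ∈ D then 1 else 0

/-- The bond polytope `BOND(G) ⊆ ℝ^E`. -/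
noncomputable def bondPolytope (G : SimpleGraph V) : Set (↥G.edgeSet → ℝ) :=
  convexHull ℝ {x | ∃ D, IsBond G D ∧ x = indVec G D}

/-- The cut polytope `CUT(G) ⊆ ℝ^E`. -/
noncomputable def cutPolytope (G : SimpleGraph V) : Set (↥G.edgeSet → ℝ) :=
  convexHull ℝ {x | ∃ D, IsCut G D ∧ x = indVec G D}

/-- `a^T x`. -/
noncomputable def dot {ι : Type*} [Fintype ι] (a x : ι → ℝ) : ℝ := ∑ i, a i * x i

/-- Affine dimension of a set of points. -/
noncomputable def affDim {W : Type*} [AddCommGroup W] [Module ℝ W] (s : Set W) : ℕ :=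
  Module.finrank ℝ ↥(vectorSpan ℝ s)

/-- `a^T x ≤ b` is facet-defining for `P`. -/
def IsFacet {ι : Type*} [Fintype ι] (P : Set (ι → ℝ)) (a : ι → ℝ) (b : ℝ) : Prop :=
  a ≠ 0 ∧ (∀ x ∈ P, dot a x ≤ b) ∧ {x ∈ P | dot a x = b}.Nonempty ∧
    affDim {x ∈ P | dot a x = b} + 1 = affDim P


/-- The cycle given by the closed walk `c` is interleaved: there are four vertices
appearing in this cyclic order along `c` that are connected crosswise by two
vertex-disjoint paths in `G - E(c)`. -/
def IsInterleaved (G : SimpleGraph V) {v : V} (c : G.Walk v v) : Prop :=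
  ∃ i₁ i₂ i₃ i₄ : ℕ, i₁ < i₂ ∧ i₂ < i₃ ∧ i₃ < i₄ ∧ i₄ < c.length ∧
    ∃ (q₁ : (G.deleteEdges {e | e ∈ c.edges}).Walk (c.getVert i₁) (c.getVert i₃))
      (q₂ : (G.deleteEdges {e | e ∈ c.edges}).Walk (c.getVert i₂) (c.getVert i₄)),
      q₁.IsPath ∧ q₂.IsPath ∧ ∀ x ∈ q₁.support, x ∉ q₂.support

/-- The endpoints of an edge of a closed walk are consecutive vertices of the walk. -/
theorem mem_edges_cases {G : SimpleGraph V} {v : V} {c : G.Walk v v} {a b : V}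
    (h : s(a, b) ∈ c.edges) : ∃ i < c.length,
      (a = c.getVert i ∧ b = c.getVert (i + 1)) ∨ (b = c.getVert i ∧ a = c.getVert (i + 1)) := by
  obtain ⟨i, hi, h⟩ := (c.mk_mem_edges_iff_exists).1 h
  refine ⟨i, hi, ?_⟩
  rcases Sym2.eq_iff.1 h with ⟨h₁, h₂⟩ | ⟨h₁, h₂⟩
  · exact .inl ⟨h₁.symm, h₂.symm⟩
  · exact .inr ⟨h₁.symm, h₂.symm⟩

theorem getVert_injective {G : SimpleGraph V} {v : V} {c : G.Walk v v} (hc : c.IsCycle)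
    {i j : ℕ} (hi : i < c.length) (hj : j < c.length) (h : c.getVert i = c.getVert j) : i = j :=
  hc.getVert_injOn' (by simp only [Set.mem_ofPred_eq]; omega)
    (by simp only [Set.mem_ofPred_eq]; omega) h

/-- If `G[S]` is connected and `P` does not separate the ends of any edge of `c` inside `S`, then
some vertices of `c` separated by `P` are joined by a walk inside `S` avoiding the edges of `c`. -/
theorem exists_walk_of_separates {G : SimpleGraph V} {v : V} {c : G.Walk v v} {S : Set V}
    (hS : (G.induce S).Preconnected) {P : V → Prop}
    (hP : ∀ a b, a ∈ S → b ∈ S → s(a, b) ∈ c.edges → P a → P b)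
    {x y : V} (hx : x ∈ S) (hy : y ∈ S) (hxc : x ∈ c.support) (hyc : y ∈ c.support)
    (hPx : P x) (hPy : ¬ P y) :
    ∃ a b, a ∈ c.support ∧ b ∈ c.support ∧ P a ∧ ¬ P b ∧
      ∃ q : (G.deleteEdges {e | e ∈ c.edges}).Walk a b, ∀ z ∈ q.support, z ∈ S := by
  by_contra hno
  have key : ∀ u w : S, (G.induce S).Walk u w →
      (∃ a ∈ c.support, P a ∧ ∃ q : (G.deleteEdges {e | e ∈ c.edges}).Walk a u,
        ∀ z ∈ q.support, z ∈ S) →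
      ∃ a ∈ c.support, P a ∧ ∃ q : (G.deleteEdges {e | e ∈ c.edges}).Walk a w,
        ∀ z ∈ q.support, z ∈ S := by
    intro u w p
    induction p with
    | nil => exact id
    | @cons u u' w h p ih =>
      rintro ⟨a, hac, hPa, q, hq⟩
      apply ih
      have hadj : G.Adj u u' := h
      by_cases he : s((u : V), (u' : V)) ∈ c.edges
      · have hPu : P u := by
          by_contra hPu
          exact hno ⟨a, u, hac, c.fst_mem_support_of_mem_edges he, hPa, hPu, q, hq⟩
        exact ⟨u', c.snd_mem_support_of_mem_edges he, hP u u' u.2 u'.2 he hPu, .nil, by simp⟩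
      · have hH : (G.deleteEdges {e | e ∈ c.edges}).Adj u u' := by
          rw [SimpleGraph.deleteEdges_adj]
          exact ⟨hadj, he⟩
        refine ⟨a, hac, hPa, q.concat hH, fun z hz => ?_⟩
        rw [SimpleGraph.Walk.support_concat] at hz
        rcases List.mem_append.1 hz with hz | hz
        · exact hq z hz
        · rw [List.mem_singleton.1 hz]
          exact u'.2
  obtain ⟨p⟩ := hS ⟨x, hx⟩ ⟨y, hy⟩
  obtain ⟨a, hac, hPa, q, hq⟩ := key _ _ p ⟨x, hxc, hPx, .nil, by simpa using hx⟩
  exact hno ⟨a, y, hac, hyc, hPa, hPy, q, hq⟩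

theorem exists_getVert_lt_length {G : SimpleGraph V} {v : V} {c : G.Walk v v} (hc : c.IsCycle)
    {a : V} (ha : a ∈ c.support) : ∃ i < c.length, c.getVert i = a := by
  obtain ⟨i, rfl, hi⟩ := SimpleGraph.Walk.mem_support_iff_exists_getVert.1 ha
  rcases hi.lt_or_eq with hi | rfl
  · exact ⟨i, hi, rfl⟩
  · exact ⟨0, by have := hc.three_le_length; omega, by simp⟩

/-- If `G[S]` is connected and both arcs between two vertices of the cycle outside `S` meet `S`,
then some walk inside `S` avoiding the cycle edges joins the two arcs. -/
theorem exists_walk_between_arcs {G : SimpleGraph V} {v : V} {c : G.Walk v v} (hc : c.IsCycle)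
    {S : Set V} (hS : (G.induce S).Preconnected) {l m h k : ℕ} (hlm : l < m) (hmh : m < h)
    (hh : h < c.length) (hk : k < c.length) (hkout : k < l ∨ h < k)
    (hlS : c.getVert l ∉ S) (hhS : c.getVert h ∉ S) (hmS : c.getVert m ∈ S)
    (hkS : c.getVert k ∈ S) :
    ∃ p q, l < p ∧ p < h ∧ q < c.length ∧ (q < l ∨ h < q) ∧
      ∃ w : (G.deleteEdges {e | e ∈ c.edges}).Walk (c.getVert p) (c.getVert q),
        ∀ z ∈ w.support, z ∈ S := by
  obtain ⟨a, b, hac, hbc, ⟨p, hlp, hph, rfl⟩, hb, w, hw⟩ :=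
    exists_walk_of_separates (c := c) hS (P := fun x => ∃ i, l < i ∧ i < h ∧ c.getVert i = x)
      (by
        rintro a b haS hbS hab ⟨i, hli, hih, rfl⟩
        obtain ⟨j, hj, ⟨h₁, rfl⟩ | ⟨rfl, h₁⟩⟩ := mem_edges_cases hab
        · obtain rfl := getVert_injective hc (by omega) hj h₁
          refine ⟨i + 1, by omega, ?_, rfl⟩
          by_contra hcon
          obtain rfl : i + 1 = h := by omega
          exact hhS hbS
        · by_cases hj' : j + 1 < c.length
          · obtain rfl := getVert_injective hc (by omega) hj' h₁
            refine ⟨j, ?_, by omega, rfl⟩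
            by_contra hcon
            obtain rfl : j = l := by omega
            exact hlS hbS
          · have h0 : c.getVert (j + 1) = c.getVert 0 := by
              rw [show j + 1 = c.length by omega]
              simp
            have := getVert_injective hc (by omega) (by omega) (h₁.trans h0)
            omega)
      hmS hkS (c.getVert_mem_support m) (c.getVert_mem_support k) ⟨m, hlm, hmh, rfl⟩
      (by
        rintro ⟨i, hli, hih, hi⟩
        have := getVert_injective hc (by omega) hk hi
        omega)
  obtain ⟨q, hq, rfl⟩ := exists_getVert_lt_length hc hbc
  refine ⟨p, q, hlp, hph, hq, ?_, w, hw⟩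
  have hqS : c.getVert q ∈ S := hw _ w.end_mem_support
  by_contra hcon
  have hql : q ≠ l := by rintro rfl; exact hlS hqS
  have hqh : q ≠ h := by rintro rfl; exact hhS hqS
  exact hb ⟨q, by omega, by omega, rfl⟩

theorem isInterleaved_of_walks {G : SimpleGraph V} {v : V} {c : G.Walk v v} {S : Set V}
    {i₁ i₂ i₃ i₄ : ℕ} (h₁₂ : i₁ < i₂) (h₂₃ : i₂ < i₃) (h₃₄ : i₃ < i₄) (h₄ : i₄ < c.length)
    (q₁ : (G.deleteEdges {e | e ∈ c.edges}).Walk (c.getVert i₁) (c.getVert i₃))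
    (q₂ : (G.deleteEdges {e | e ∈ c.edges}).Walk (c.getVert i₂) (c.getVert i₄))
    (h₁ : ∀ z ∈ q₁.support, z ∈ S) (h₂ : ∀ z ∈ q₂.support, z ∉ S) : IsInterleaved G c := by
  classical
  exact ⟨i₁, i₂, i₃, i₄, h₁₂, h₂₃, h₃₄, h₄, q₁.bypass, q₂.bypass, q₁.bypass_isPath,
    q₂.bypass_isPath, fun x hx hx' => h₂ x (q₂.support_bypass_subset_support hx')
      (h₁ x (q₁.support_bypass_subset_support hx))⟩

theorem isInterleaved_of_alternating {G : SimpleGraph V} {v : V} {c : G.Walk v v} (hc : c.IsCycle)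
    {S : Set V} (hS : (G.induce S).Preconnected) (hS' : (G.induce Sᶜ).Preconnected)
    {i₁ i₂ i₃ i₄ : ℕ} (h₁₂ : i₁ < i₂) (h₂₃ : i₂ < i₃) (h₃₄ : i₃ < i₄) (h₄ : i₄ < c.length)
    (h₁S : c.getVert i₁ ∈ S) (h₂S : c.getVert i₂ ∉ S) (h₃S : c.getVert i₃ ∈ S)
    (h₄S : c.getVert i₄ ∉ S) : IsInterleaved G c := by
  obtain ⟨p, q, hp, hp', hq, hpq, w, hw⟩ := exists_walk_between_arcs hc hS h₂₃ h₃₄ h₄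
    (h₁₂.trans (h₂₃.trans (h₃₄.trans h₄))) (.inl h₁₂) h₂S h₄S h₃S h₁S
  have hpS : c.getVert p ∉ Sᶜ := fun h => h (hw _ w.start_mem_support)
  have hqS : c.getVert q ∉ Sᶜ := fun h => h (hw _ w.end_mem_support)
  have key : ∀ l h, l < h → h < c.length →
      (∃ u : (G.deleteEdges {e | e ∈ c.edges}).Walk (c.getVert l) (c.getVert h),
        ∀ z ∈ u.support, z ∈ S) → ∀ r s, l < r → r < h → s < c.length → (s < l ∨ h < s) →
      (∃ u : (G.deleteEdges {e | e ∈ c.edges}).Walk (c.getVert r) (c.getVert s),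
        ∀ z ∈ u.support, z ∈ Sᶜ) → IsInterleaved G c := by
    rintro l h hlh hh ⟨u, hu⟩ r s hlr hrh hs hout ⟨t, ht⟩
    rcases hout with hout | hout
    · exact isInterleaved_of_walks (S := Sᶜ) hout hlr hrh hh t.reverse u
        (by simpa using ht) (fun z hz hz' => hz' (hu z hz))
    · exact isInterleaved_of_walks (S := S) hlr hrh hout hs u t hu ht
  rcases hpq with hqi | hqi
  · obtain ⟨r, s, hr, hr', hs, hrs, t, ht⟩ := exists_walk_between_arcs hc hS'
      (l := q) (m := i₂) (h := p) (k := i₄) hqi hp (by omega) h₄ (.inr hp') hqS hpS h₂S h₄S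
    exact key q p (by omega) (by omega) ⟨w.reverse, by simpa using hw⟩ r s hr hr' hs hrs ⟨t, ht⟩
  · obtain ⟨r, s, hr, hr', hs, hrs, t, ht⟩ := exists_walk_between_arcs hc hS'
      (l := p) (m := i₄) (h := q) (k := i₂) hp' hqi hq (by omega) (.inl hp) hpS hqS h₄S h₂S
    exact key p q (by omega) hq ⟨w, hw⟩ r s hr hr' hs hrs ⟨t, ht⟩

open Classical in
/-- A closed two-coloured sequence without four alternating terms that is not constant changes
colour exactly twice. -/
theorem card_changes_eq_two {n : ℕ} {χ : ℕ → Prop} (h0 : χ 0) (hn : χ n)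
    (halt : ∀ i j k, 0 < i → i < j → j < k → k < n → ¬ χ i → χ j → χ k) {m : ℕ} (hm : m < n)
    (hχ : ¬ (χ m ↔ χ (m + 1))) : #{i ∈ range n | ¬ (χ i ↔ χ (i + 1))} = 2 := by
  have hex : ∃ i, ¬ χ i := by
    by_contra! hall
    exact hχ ⟨fun _ => hall _, fun _ => hall _⟩
  set a := Nat.find hex with ha
  have haχ : ¬ χ a := Nat.find_spec hex
  have hlt : ∀ i < a, χ i := fun i hi => not_not.1 (Nat.find_min hex hi)
  have ha0 : a ≠ 0 := fun h => haχ (h ▸ h0)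
  have han : a < n := by
    by_contra! hna
    rcases hna.lt_or_eq with h | h
    · exact hχ ⟨fun _ => hlt _ (by omega), fun _ => hlt _ (by omega)⟩
    · exact haχ (h ▸ hn)
  have hex' : ∃ i, a < i ∧ χ i := ⟨n, han, hn⟩
  set b := Nat.find hex' with hb
  obtain ⟨hab, hbχ⟩ : a < b ∧ χ b := Nat.find_spec hex'
  have hbn : b ≤ n := Nat.find_min' hex' ⟨han, hn⟩
  have hmid : ∀ i, a ≤ i → i < b → ¬ χ i := by
    intro i hai hib hi
    rcases hai.lt_or_eq with h | h
    · exact Nat.find_min hex' hib ⟨h, hi⟩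
    · exact haχ (h ▸ hi)
  have hge : ∀ i, b ≤ i → i ≤ n → χ i := by
    intro i hbi hin
    rcases hbi.lt_or_eq with h | h
    · rcases hin.lt_or_eq with h' | h'
      · exact halt a b i (by omega) hab h h' haχ hbχ
      · exact h' ▸ hn
    · exact h ▸ hbχ
  have heq : {i ∈ range n | ¬ (χ i ↔ χ (i + 1))} = {a - 1, b - 1} := by
    ext i
    simp only [Finset.mem_filter, Finset.mem_range, Finset.mem_insert, Finset.mem_singleton]
    constructor
    · rintro ⟨hi, h⟩
      by_contra hcon
      apply h
      rcases lt_or_ge i a with h₁ | h₁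
      · exact ⟨fun _ => hlt _ (by omega), fun _ => hlt _ h₁⟩
      · rcases lt_or_ge i b with h₂ | h₂
        · exact ⟨fun h => absurd h (hmid _ h₁ h₂),
            fun h => absurd h (hmid _ (by omega) (by omega))⟩
        · exact ⟨fun _ => hge _ (by omega) (by omega), fun _ => hge _ h₂ (by omega)⟩
    · rintro (rfl | rfl)
      · refine ⟨by omega, fun h => ?_⟩
        rw [Nat.sub_add_cancel (by omega)] at h
        exact haχ (h.1 (hlt _ (by omega)))
      · refine ⟨by omega, fun h => ?_⟩
        rw [Nat.sub_add_cancel (by omega)] at h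
        exact hmid _ (by omega) (by omega) (h.2 hbχ)
  rw [heq, Finset.card_pair (by omega)]

theorem mk_mem_cut {G : SimpleGraph V} {S : Set V} {a b : V} (h : G.Adj a b) :
    s(a, b) ∈ cut G S ↔ ¬ (a ∈ S ↔ b ∈ S) := by
  constructor
  · rintro ⟨-, u, w, he, hu, hw⟩
    rcases Sym2.eq_iff.1 he with ⟨rfl, rfl⟩ | ⟨rfl, rfl⟩ <;> tauto
  · intro hne
    refine ⟨h, ?_⟩
    by_cases ha : a ∈ S
    · exact ⟨a, b, rfl, ha, by tauto⟩
    · exact ⟨b, a, Sym2.eq_swap, by tauto, ha⟩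

open Classical in
/-- A bond meets a non-interleaved cycle in two edges if it meets it at all. -/
theorem card_cut_cycle_eq_two {G : SimpleGraph V} {v : V} {c : G.Walk v v} (hc : c.IsCycle)
    (hni : ¬ IsInterleaved G c) {S : Set V} (hS : (G.induce S).Preconnected)
    (hS' : (G.induce Sᶜ).Preconnected) {m : ℕ} (hm : m < c.length)
    (hcut : ¬ (c.getVert m ∈ S ↔ c.getVert (m + 1) ∈ S)) :
    #{i ∈ range c.length | ¬ (c.getVert i ∈ S ↔ c.getVert (i + 1) ∈ S)} = 2 := by
  by_cases h0 : c.getVert 0 ∈ S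
  · refine card_changes_eq_two (χ := fun i => c.getVert i ∈ S) h0 (by simpa using h0) ?_ hm hcut
    intro i j k h₁ h₂ h₃ h₄ hi hj
    by_contra hk
    exact hni (isInterleaved_of_alternating hc hS hS' h₁ h₂ h₃ h₄ h0 hi hj hk)
  · have := card_changes_eq_two (χ := fun i => c.getVert i ∉ S) h0 (by simpa using h0)
      (n := c.length) ?_ hm (by rwa [not_iff_not])
    · simpa only [not_iff_not] using this
    intro i j k h₁ h₂ h₃ h₄ hi hj
    by_contra hk
    exact hni (isInterleaved_of_alternating hc hS' (by rwa [compl_compl]) h₁ h₂ h₃ h₄ h0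
      hi hj (not_not.2 hk))

/-- In a connected graph, the component of `u` in `G - z` is one side of a bond. -/
theorem exists_bond_side {G : SimpleGraph V} (hG : G.Connected) {u w z : V} (h : G.Adj u w)
    (hzu : z ≠ u) (hzw : z ≠ w) :
    ∃ S : Set V, (G.induce S).Preconnected ∧ (G.induce Sᶜ).Preconnected ∧
      u ∈ S ∧ w ∈ S ∧ z ∉ S := by
  classical
  set S : Set V := {x | ∃ q : G.Walk u x, z ∉ q.support} with hSdef
  have hstep : ∀ {x y}, x ∈ S → G.Adj x y → z ≠ y → y ∈ S := by
    rintro x y ⟨q, hq⟩ hxy hzy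
    exact ⟨q.concat hxy, by simp [SimpleGraph.Walk.support_concat, hq, hzy]⟩
  have huS : u ∈ S := ⟨.nil, by simpa using hzu⟩
  have hzS : z ∉ S := fun ⟨q, hq⟩ => hq q.end_mem_support
  have hin : ∀ x : S, (G.induce S).Reachable ⟨u, huS⟩ x := by
    rintro ⟨x, q, hq⟩
    refine ⟨q.induce S fun y hy => ⟨q.takeUntil y hy, fun hz => hq ?_⟩⟩
    exact q.support_takeUntil_subset_support hy hz
  have hout : ∀ x : (Sᶜ : Set V), (G.induce Sᶜ).Reachable x ⟨z, hzS⟩ := by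
    rintro ⟨x, hx⟩
    obtain ⟨p⟩ := hG.preconnected x z
    clear hin huS hzw hzu
    induction p with
    | nil => exact .rfl
    | @cons x y z' hxy p ih =>
      by_cases hxz : x = z'
      · subst hxz
        exact .rfl
      · have hy : y ∉ S := fun hy => hx (hstep hy hxy.symm (Ne.symm hxz))
        exact SimpleGraph.Reachable.trans
          (SimpleGraph.Adj.reachable (show (G.induce Sᶜ).Adj ⟨x, hx⟩ ⟨y, hy⟩ from hxy))
          (ih hSdef hstep hzS hy)
  exact ⟨S, fun x y => (hin x).symm.trans (hin y), fun x y => (hout x).trans (hout y).symm,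
    huS, hstep huS h hzw, hzS⟩

/-- The coordinate sum over the edges of a closed walk. -/
noncomputable def walkSum {G : SimpleGraph V} {v : V} (c : G.Walk v v) :
    (↥G.edgeSet → ℝ) →ₗ[ℝ] ℝ :=
  ∑ i : Fin c.length, LinearMap.proj (⟨s(c.getVert i, c.getVert (i + 1)),
    c.adj_getVert_succ i.2⟩ : ↥G.edgeSet)

open Classical in
theorem walkSum_indVec {G : SimpleGraph V} {v : V} (c : G.Walk v v) (S : Set V) :
    walkSum c (indVec G (cut G S)) =
      #{i ∈ range c.length | ¬ (c.getVert i ∈ S ↔ c.getVert (i + 1) ∈ S)} := by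
  rw [Finset.card_filter, Nat.cast_sum, ← Fin.sum_univ_eq_sum_range
    (fun i => ((if ¬ (c.getVert i ∈ S ↔ c.getVert (i + 1) ∈ S) then 1 else 0 : ℕ) : ℝ))]
  simp only [walkSum, LinearMap.sum_apply, LinearMap.proj_apply, indVec]
  refine Finset.sum_congr rfl fun i _ => ?_
  simp only [mk_mem_cut (c.adj_getVert_succ i.2)]
  push_cast
  rfl

theorem indVec_eq_one_or_zero {G : SimpleGraph V} {D : Set (Sym2 V)} (e : ↥G.edgeSet) :
    indVec G D e = 1 ∧ (e : Sym2 V) ∈ D ∨ indVec G D e = 0 ∧ (e : Sym2 V) ∉ D := by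
  by_cases h : (e : Sym2 V) ∈ D <;> simp [indVec, h]

theorem walkSum_bounds {G : SimpleGraph V} {v : V} {c : G.Walk v v} (hc : c.IsCycle)
    (hni : ¬ IsInterleaved G c) {e : ↥G.edgeSet} (he : (e : Sym2 V) ∈ c.edges)
    {x : ↥G.edgeSet → ℝ} (hx : x ∈ bondPolytope G) :
    2 * x e ≤ walkSum c x ∧ walkSum c x ≤ 2 := by
  classical
  have hconv : Convex ℝ {x : ↥G.edgeSet → ℝ | 2 * x e ≤ walkSum c x ∧ walkSum c x ≤ 2} := by
    intro x hx y hy a b ha hb hab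
    simp only [Set.mem_ofPred_eq, map_add, map_smul, smul_eq_mul, Pi.add_apply,
      Pi.smul_apply] at hx hy ⊢
    constructor
    · nlinarith [mul_le_mul_of_nonneg_left hx.1 ha, mul_le_mul_of_nonneg_left hy.1 hb]
    · nlinarith [mul_le_mul_of_nonneg_left hx.2 ha, mul_le_mul_of_nonneg_left hy.2 hb]
  refine convexHull_min ?_ hconv hx
  rintro _ ⟨_, ⟨S, rfl, hS, hS'⟩, rfl⟩
  rw [Set.mem_ofPred_eq, walkSum_indVec]
  by_cases hm : ∃ m < c.length, ¬ (c.getVert m ∈ S ↔ c.getVert (m + 1) ∈ S)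
  · obtain ⟨m, hm, hcut⟩ := hm
    rw [card_cut_cycle_eq_two hc hni hS hS' hm hcut]
    rcases indVec_eq_one_or_zero (D := cut G S) e with ⟨h, -⟩ | ⟨h, -⟩ <;> norm_num [h]
  · push Not at hm
    have hcut : (e : Sym2 V) ∉ cut G S := by
      obtain ⟨e, heG⟩ := e
      induction e with
      | h a b =>
        obtain ⟨i, hi, h⟩ := c.mk_mem_edges_iff_exists.1 he
        change s(a, b) ∉ cut G S
        rw [← h, mk_mem_cut (c.adj_getVert_succ hi)]
        exact not_not.2 (hm i hi)
    rw [Finset.filter_false_of_mem (by simpa using hm)]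
    rcases indVec_eq_one_or_zero (D := cut G S) e with ⟨-, h⟩ | ⟨h, -⟩
    · exact absurd h hcut
    · norm_num [h]

/-- Every edge of a cycle misses some bond that meets the cycle. -/
theorem exists_bond_avoiding {G : SimpleGraph V} (hG : G.Connected) {v : V} {c : G.Walk v v}
    (hc : c.IsCycle) (hni : ¬ IsInterleaved G c) {e : ↥G.edgeSet} (he : (e : Sym2 V) ∈ c.edges) :
    ∃ y ∈ bondPolytope G, y e = 0 ∧ walkSum c y = 2 := by
  classical
  obtain ⟨e, heG⟩ := e
  induction e with
  | h a b =>
    have h3 := hc.three_le_length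
    have hn0 : c.getVert c.length = c.getVert 0 := by simp
    obtain ⟨j, hj, hje⟩ := c.mk_mem_edges_iff_exists.1 he
    obtain ⟨k, hk, hkj, hkj'⟩ : ∃ k < c.length,
        c.getVert k ≠ c.getVert j ∧ c.getVert k ≠ c.getVert (j + 1) := by
      have hne : ∀ {p q}, p < c.length → q < c.length → p ≠ q →
          c.getVert p ≠ c.getVert q := fun hp hq hpq h => hpq (getVert_injective hc hp hq h)
      by_cases h₁ : j + 1 < c.length
      · by_cases h₂ : j + 2 < c.length
        · exact ⟨j + 2, h₂, hne h₂ hj (by omega), hne h₂ h₁ (by omega)⟩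
        · exact ⟨0, by omega, hne (by omega) hj (by omega), hne (by omega) h₁ (by omega)⟩
      · rw [show j + 1 = c.length by omega, hn0]
        exact ⟨1, by omega, hne (by omega) hj (by omega), hne (by omega) (by omega) (by omega)⟩
    obtain ⟨S, hS, hS', hu, hw, hz⟩ := exists_bond_side hG (c.adj_getVert_succ hj) hkj hkj'
    refine ⟨_, subset_convexHull ℝ _ ⟨_, ⟨S, rfl, hS, hS'⟩, rfl⟩, ?_, ?_⟩
    · have : s(a, b) ∉ cut G S := by
        rw [← hje, mk_mem_cut (c.adj_getVert_succ hj)]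
        tauto
      simp [indVec, this]
    · obtain ⟨m, hm, hcut⟩ : ∃ m < c.length,
          ¬ (c.getVert m ∈ S ↔ c.getVert (m + 1) ∈ S) := by
        by_contra! hcon
        have hconst : ∀ i ≤ c.length, (c.getVert i ∈ S ↔ c.getVert 0 ∈ S) := by
          intro i
          induction i with
          | zero => simp
          | succ i ih => exact fun hi => (hcon i (by omega)).symm.trans (ih (by omega))
        exact hz ((hconst k hk.le).2 ((hconst j hj.le).1 hu))
      rw [walkSum_indVec, card_cut_cycle_eq_two hc hni hS hS' hm hcut]
      norm_num

theorem zero_mem_bondPolytope {G : SimpleGraph V} (hG : G.Connected) :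
    (0 : ↥G.edgeSet → ℝ) ∈ bondPolytope G := by
  refine subset_convexHull ℝ _ ⟨_, ⟨∅, rfl, fun x => x.2.elim, ?_⟩, ?_⟩
  · intro x y
    obtain ⟨p⟩ := hG.preconnected x y
    exact ⟨p.induce _ fun _ _ => by simp⟩
  · ext e
    simp [indVec, cut]

theorem edge_in_noninterleaved_cycle_not_facet {V : Type*} [Fintype V] [DecidableEq V]
    (G : SimpleGraph V) [DecidableRel G.Adj] (hG : G.Connected)
    (e : ↥G.edgeSet) (v : V) (c : G.Walk v v) (hc : c.IsCycle)
    (he : (e : Sym2 V) ∈ c.edges) (hni : ¬ IsInterleaved G c) :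
    ¬ IsFacet (bondPolytope G) (fun f => if f = e then (1 : ℝ) else 0) 1 := by
  rintro ⟨-, -, ⟨z, hzP, hz⟩, hdim⟩
  have hdot : ∀ x : ↥G.edgeSet → ℝ, dot (fun f => if f = e then (1 : ℝ) else 0) x = x e :=
    fun x => by simp [dot]
  simp only [hdot] at hz hdim
  obtain ⟨y, hyP, hye, hyc⟩ := exists_bond_avoiding hG hc hni he
  have hspan : ∀ x ∈ bondPolytope G, x ∈ vectorSpan ℝ (bondPolytope G) := fun x hx => by
    simpa using vsub_mem_vectorSpan ℝ hx (zero_mem_bondPolytope hG)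
  set F := {x | x ∈ bondPolytope G ∧ x e = 1}
  have hFe : ∀ d ∈ vectorSpan ℝ F, d e = 0 ∧ walkSum c d = 0 := by
    have : vectorSpan ℝ F ≤ LinearMap.ker (LinearMap.proj e : (↥G.edgeSet → ℝ) →ₗ[ℝ] ℝ) ⊓
        LinearMap.ker (walkSum c) := by
      refine Submodule.span_le.2 ?_
      rintro _ ⟨p, ⟨hpP, hpe⟩, q, ⟨hqP, hqe⟩, rfl⟩
      have hp := walkSum_bounds hc hni he hpP
      have hq := walkSum_bounds hc hni he hqP
      simp only [vsub_eq_sub, SetLike.mem_coe, Submodule.mem_inf, LinearMap.mem_ker,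
        LinearMap.proj_apply, map_sub]
      constructor <;> linarith
    exact fun d hd => this hd
  set K := vectorSpan ℝ (bondPolytope G) ⊓
    LinearMap.ker (LinearMap.proj e : (↥G.edgeSet → ℝ) →ₗ[ℝ] ℝ)
  have hFK : vectorSpan ℝ F < K := by
    refine lt_of_le_of_ne (fun d hd => ⟨vectorSpan_mono ℝ (fun x hx => hx.1) hd, (hFe d hd).1⟩) ?_
    intro h
    have hy : y ∈ vectorSpan ℝ F := h ▸ ⟨hspan y hyP, hye⟩
    linarith [(hFe y hy).2]
  have hKP : K < vectorSpan ℝ (bondPolytope G) := by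
    refine lt_of_le_of_ne inf_le_left fun h => ?_
    have hzK : z ∈ K := h ▸ hspan z hzP
    have hz0 : z e = 0 := hzK.2
    linarith
  have h₁ := Submodule.finrank_lt_finrank_of_lt hFK
  have h₂ := Submodule.finrank_lt_finrank_of_lt hKP
  unfold affDim at hdim
  omega

end BondPolytope
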